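/- arXiv:2502.11394 — 3 statements merged into one kernel-verified Lean document; each statement's English description precedes it below -/
import Mathlib

section
/- Let Â be a real n×n matrix and X a real n×d matrix, and set M = ÂX. Assume every column of M has positive empirical variance, i.e. σ_j² = (1/n)·Σ_{i=1}^n (M_{ij} − (1/n)Σ_{k=1}^n M_{kj})² > 0 for each j, and let Γ = diag(σ_1,…,σ_d) and X̃ = XΓ^{-1}. Then the (ε = 0, non-affine) BatchNorm output of M, defined entrywise by BN(M)_{ij} = (M_{ij} − (1/n)Σ_{k=1}^n M_{kj})/σ_j, satisfies the signed-propagation identity BN(ÂX) = Â X̃ − ((1/n)𝟙𝟙ᵀ Â) X̃; that is, BatchNorm equals message passing on the normalized features X̃ with positive adjacency matrix Â and negative adjacency matrix (1/n)𝟙𝟙ᵀÂ. -/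
open Finset Matrix

/-- **BatchNorm as signed-graph propagation.**
Let `Â` be a real `n×n` matrix, `X` a real `n×d` matrix, `M = ÂX`.  Assume every
column of `M` has positive empirical standard deviation `σ j`, let `Γ = diag σ`,
`X̃ = X Γ⁻¹`.  Then the (ε = 0, non-affine) BatchNorm output of `M`,
`BN(M)ᵢⱼ = (Mᵢⱼ − meanⱼ)/σⱼ`, satisfies
`BN(ÂX) = Â X̃ − ((1/n)𝟙𝟙ᵀ Â) X̃`. -/
theorem batchNorm_eq_signed_propagation
    {n d : ℕ} (hn : 0 < n)
    (Ahat : Matrix (Fin n) (Fin n) ℝ) (X : Matrix (Fin n) (Fin d) ℝ)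
    (M : Matrix (Fin n) (Fin d) ℝ) (hM : M = Ahat * X)
    (σ : Fin d → ℝ)
    (hσpos : ∀ j, 0 < σ j)
    (hσ : ∀ j, (σ j) ^ 2 =
      (1 / (n : ℝ)) * ∑ i, (M i j - (1 / (n : ℝ)) * ∑ k, M k j) ^ 2)
    (Γ : Matrix (Fin d) (Fin d) ℝ) (hΓ : Γ = Matrix.diagonal σ)
    (Xtilde : Matrix (Fin n) (Fin d) ℝ)
    (hXtilde : Xtilde = X * Γ⁻¹)
    (BN : Matrix (Fin n) (Fin d) ℝ)
    (hBN : ∀ i j, BN i j = (M i j - (1 / (n : ℝ)) * ∑ k, M k j) / σ j) :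
    BN = Ahat * Xtilde -
      ((1 / (n : ℝ)) • (Matrix.of fun _ _ : Fin n => (1 : ℝ)) * Ahat) * Xtilde := by
  have hinv : Γ⁻¹ = Matrix.diagonal (fun j => (σ j)⁻¹) := by
    apply Matrix.inv_eq_right_inv
    rw [hΓ, Matrix.diagonal_mul_diagonal, ← Matrix.diagonal_one]
    congr 1
    funext j
    exact mul_inv_cancel₀ (hσpos j).ne'
  have h1 : Ahat * Xtilde = M * Matrix.diagonal (fun j => (σ j)⁻¹) := by
    rw [hXtilde, hinv, hM, Matrix.mul_assoc]
  ext i j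
  rw [Matrix.mul_assoc, h1, hBN, Matrix.sub_apply, Matrix.mul_diagonal, ← Matrix.mul_assoc,
    Matrix.mul_diagonal, Matrix.mul_apply]
  simp only [Matrix.smul_apply, Matrix.of_apply, smul_eq_mul, mul_one]
  rw [← Finset.mul_sum, div_eq_mul_inv, sub_mul]
end

section
/- Let G_s be a signed graph on n ≥ 2 nodes whose positive subgraph G⁺ is connected and whose negative subgraph G⁻ contains at least one edge. Let L⁺ and L⁻ be the graph Laplacians of G⁺ and G⁻ respectively, let Δ⁺ be the maximum degree of G⁺, and consider the linear dynamics x(t+1) = (I − αL⁺ + βL⁻) x(t) on ℝⁿ. Then for every α with 0 < α < 1/Δ⁺, there exists a critical value β* > 0 such that: (i) if 0 ≤ β < β*, then for every initial value x(0) ∈ ℝⁿ, lim_{t→∞} x_i(t) = (1/n)Σ_{j=1}^n x_j(0) for all i; and (ii) if β > β*, then for Lebesgue-almost-every initial value x(0) ∈ ℝⁿ, lim_{t→∞} ‖x(t)‖ = ∞. -/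
open Finset Matrix Filter Topology MeasureTheory

lemma aux_spec {n : ℕ} (M : Matrix (Fin n) (Fin n) ℝ) (hM : M.IsHermitian) :
    ∃ (l : Fin n → ℝ) (v : Fin n → Fin n → ℝ),
      (∀ i, M *ᵥ v i = l i • v i) ∧ (∀ i, v i ⬝ᵥ v i = 1) ∧
      (∀ x : Fin n → ℝ, x = ∑ i, (v i ⬝ᵥ x) • v i) := by
  refine ⟨hM.eigenvalues, fun i => ⇑(hM.eigenvectorBasis i), hM.mulVec_eigenvectorBasis, ?_, ?_⟩
  · intro i
    have h := hM.eigenvectorBasis.orthonormal.1 i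
    have h2 : inner ℝ (hM.eigenvectorBasis i) (hM.eigenvectorBasis i) = (1 : ℝ) := by
      rw [real_inner_self_eq_norm_sq, h]; norm_num
    rw [EuclideanSpace.inner_eq_star_dotProduct] at h2
    simpa using h2
  · intro x
    have h := hM.eigenvectorBasis.sum_repr' (WithLp.toLp 2 x)
    funext k
    have h3 := congrArg (fun z : EuclideanSpace ℝ (Fin n) => z k) h
    simp only [EuclideanSpace.inner_eq_star_dotProduct] at h3
    simp only [WithLp.ofLp_sum, Finset.sum_apply, WithLp.ofLp_smul, Pi.smul_apply] at h3 ⊢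
    rw [← h3]
    refine Finset.sum_congr rfl fun i _ => ?_
    rw [dotProduct_comm]
    simp

lemma aux_pow {n : ℕ} (M : Matrix (Fin n) (Fin n) ℝ) (v : Fin n → ℝ) (l : ℝ)
    (h : M *ᵥ v = l • v) (t : ℕ) : (M ^ t) *ᵥ v = l ^ t • v := by
  induction t with
  | zero => simp
  | succ t ih =>
    rw [pow_succ, ← mulVec_mulVec, h, mulVec_smul, ih, smul_smul, pow_succ, mul_comm]

lemma aux_symm {n : ℕ} (M : Matrix (Fin n) (Fin n) ℝ) (hM : M.IsHermitian) (x y : Fin n → ℝ) :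
    x ⬝ᵥ M *ᵥ y = (M *ᵥ x) ⬝ᵥ y := by
  have : Mᵀ = M := by simpa [Matrix.IsHermitian] using hM
  rw [dotProduct_mulVec, ← mulVec_transpose, this]

lemma aux_conv {n : ℕ} (M : Matrix (Fin n) (Fin n) ℝ) (hM : M.IsHermitian)
    (h1 : ∀ x : Fin n → ℝ, x ⬝ᵥ M *ᵥ x ≤ x ⬝ᵥ x)
    (h2 : ∀ x : Fin n → ℝ, 0 < x ⬝ᵥ x → -(x ⬝ᵥ x) < x ⬝ᵥ M *ᵥ x) (x : Fin n → ℝ) :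
    ∃ y, M *ᵥ y = y ∧ Tendsto (fun t : ℕ => M ^ t *ᵥ x) atTop (𝓝 y) := by
  obtain ⟨l, v, hv, hv1, hx⟩ := aux_spec M hM
  have hl1 : ∀ i, l i ≤ 1 := fun i => by
    have := h1 (v i)
    rw [hv, dotProduct_smul, hv1] at this
    simpa using this
  have hl2 : ∀ i, -1 < l i := fun i => by
    have := h2 (v i) (by rw [hv1]; norm_num)
    rw [hv, dotProduct_smul, hv1] at this
    simpa using this
  have hlim : ∀ i, ∃ c, Tendsto (fun t : ℕ => l i ^ t) atTop (𝓝 c) ∧ l i * c = c := fun i => by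
    rcases eq_or_lt_of_le (hl1 i) with h | h
    · exact ⟨1, by simp [h], by simp [h]⟩
    · exact ⟨0, tendsto_pow_atTop_nhds_zero_of_abs_lt_one (abs_lt.2 ⟨hl2 i, h⟩), by simp⟩
  choose c hc hc' using hlim
  refine ⟨∑ i, (v i ⬝ᵥ x) • c i • v i, ?_, ?_⟩
  · rw [mulVec_sum]
    refine Finset.sum_congr rfl fun i _ => ?_
    rw [mulVec_smul, mulVec_smul, hv, smul_smul (c i), mul_comm, hc']
  · have : ∀ t : ℕ, M ^ t *ᵥ x = ∑ i, (v i ⬝ᵥ x) • l i ^ t • v i := fun t => by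
      conv_lhs => rw [hx x]
      rw [mulVec_sum]
      refine Finset.sum_congr rfl fun i _ => ?_
      rw [mulVec_smul, aux_pow M _ _ (hv i)]
    simp_rw [this]
    exact tendsto_finsetSum _ fun i _ => ((hc i).smul_const _).const_smul _

lemma aux_div {n : ℕ} (M : Matrix (Fin n) (Fin n) ℝ) (hM : M.IsHermitian) (x : Fin n → ℝ)
    (h : x ⬝ᵥ x < x ⬝ᵥ M *ᵥ x) :
    volume {x0 : Fin n → ℝ | ¬ Tendsto (fun t : ℕ => Real.sqrt (∑ i, ((M ^ t *ᵥ x0) i) ^ 2))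
            atTop atTop} = 0 := by
  obtain ⟨l, v, hv, hv1, hx⟩ := aux_spec M hM
  obtain ⟨i, hi⟩ : ∃ i, 1 < l i := by
    by_contra! hcon
    have e1 : x ⬝ᵥ x = ∑ i, (v i ⬝ᵥ x) ^ 2 := by
      conv_lhs => enter [2]; rw [hx x]
      rw [dotProduct_sum]
      refine Finset.sum_congr rfl fun i _ => ?_
      rw [dotProduct_smul, dotProduct_comm x, smul_eq_mul, sq]
    have e2 : x ⬝ᵥ M *ᵥ x = ∑ i, l i * (v i ⬝ᵥ x) ^ 2 := by
      conv_lhs => enter [2, 2]; rw [hx x]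
      rw [mulVec_sum, dotProduct_sum]
      refine Finset.sum_congr rfl fun i _ => ?_
      rw [mulVec_smul, hv, dotProduct_smul, dotProduct_smul, dotProduct_comm x, smul_eq_mul,
        smul_eq_mul]
      ring
    rw [e1, e2] at h
    refine absurd h (not_lt.2 (Finset.sum_le_sum fun i _ => ?_))
    nlinarith [hcon i, sq_nonneg (v i ⬝ᵥ x)]
  let f : (Fin n → ℝ) →ₗ[ℝ] ℝ :=
    { toFun := fun y => v i ⬝ᵥ y
      map_add' := fun a b => dotProduct_add _ _ _
      map_smul' := fun a b => dotProduct_smul _ _ _ }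
  refine measure_mono_null ?_ (Measure.addHaar_submodule volume (LinearMap.ker f) ?_)
  · intro y hy
    by_contra hne
    apply hy
    have hne' : v i ⬝ᵥ y ≠ 0 := hne
    refine tendsto_atTop_mono (f := fun t : ℕ => l i ^ t * |v i ⬝ᵥ y|) ?_
      ((tendsto_pow_atTop_atTop_of_one_lt hi).atTop_mul_const (abs_pos.2 hne'))
    intro t
    have hMt : (M ^ t).IsHermitian := hM.pow t
    have key : v i ⬝ᵥ (M ^ t *ᵥ y) = l i ^ t * (v i ⬝ᵥ y) := by
      rw [aux_symm _ hMt, aux_pow M _ _ (hv i), smul_dotProduct, smul_eq_mul]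
    apply Real.le_sqrt_of_sq_le
    have cs := Finset.sum_mul_sq_le_sq_mul_sq Finset.univ (v i) (M ^ t *ᵥ y)
    have e1 : ∑ k, v i k ^ 2 = 1 := by
      rw [← hv1 i]; simp [dotProduct, sq]
    rw [e1, one_mul] at cs
    refine le_trans (le_of_eq ?_) cs
    change _ = (v i ⬝ᵥ (M ^ t *ᵥ y)) ^ 2
    rw [key, mul_pow, mul_pow, sq_abs]
  · intro htop
    have : v i ∈ LinearMap.ker f := by rw [htop]; trivial
    have h0 : v i ⬝ᵥ v i = 0 := this
    rw [hv1] at h0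
    norm_num at h0

lemma aux_quad {n : ℕ} (G : SimpleGraph (Fin n)) [DecidableRel G.Adj] (x : Fin n → ℝ) :
    x ⬝ᵥ G.lapMatrix ℝ *ᵥ x = (∑ i, ∑ j, if G.Adj i j then (x i - x j) ^ 2 else 0) / 2 := by
  rw [← SimpleGraph.lapMatrix_toLinearMap₂', toLinearMap₂'_apply']

lemma aux_nonneg {n : ℕ} (G : SimpleGraph (Fin n)) [DecidableRel G.Adj] (x : Fin n → ℝ) :
    0 ≤ x ⬝ᵥ G.lapMatrix ℝ *ᵥ x := by
  rw [aux_quad]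
  refine div_nonneg (Finset.sum_nonneg fun i _ => Finset.sum_nonneg fun j _ => ?_) (by norm_num)
  split_ifs <;> positivity

lemma aux_edge {n : ℕ} (G : SimpleGraph (Fin n)) [DecidableRel G.Adj] (x : Fin n → ℝ)
    {a b : Fin n} (h : G.Adj a b) : (x a - x b) ^ 2 ≤ 2 * (x ⬝ᵥ G.lapMatrix ℝ *ᵥ x) := by
  rw [aux_quad]
  have hnn : ∀ i j, 0 ≤ (if G.Adj i j then (x i - x j) ^ 2 else 0) := fun i j => by
    split_ifs <;> positivity
  have h1 := Finset.single_le_sum (f := fun j => if G.Adj a j then (x a - x j) ^ 2 else 0)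
    (fun j _ => hnn a j) (Finset.mem_univ b)
  have h2 := Finset.single_le_sum
    (f := fun i => ∑ j, if G.Adj i j then (x i - x j) ^ 2 else 0)
    (fun i _ => Finset.sum_nonneg fun j _ => hnn i j) (Finset.mem_univ a)
  simp only [h, if_true] at h1
  linarith

lemma aux_reach {n : ℕ} (G : SimpleGraph (Fin n)) [DecidableRel G.Adj] {a b : Fin n}
    (w : G.Walk a b) : ∃ K : ℝ, 0 ≤ K ∧ ∀ x : Fin n → ℝ,
      (x a - x b) ^ 2 ≤ K * (x ⬝ᵥ G.lapMatrix ℝ *ᵥ x) := by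
  induction w with
  | nil => exact ⟨0, le_rfl, fun x => by simp⟩
  | @cons u v w h p ih =>
    obtain ⟨K, hK, ih⟩ := ih
    refine ⟨2 * K + 4, by linarith, fun x => ?_⟩
    have h1 := ih x
    have h2 := aux_edge G x h
    nlinarith [sq_nonneg ((x u - x v) - (x v - x w))]

lemma aux_bound {n : ℕ} (Gp Gn : SimpleGraph (Fin n)) [DecidableRel Gp.Adj] [DecidableRel Gn.Adj]
    (hconn : Gp.Connected) : ∃ K : ℝ, 0 < K ∧ ∀ x : Fin n → ℝ,
      x ⬝ᵥ Gn.lapMatrix ℝ *ᵥ x ≤ K * (x ⬝ᵥ Gp.lapMatrix ℝ *ᵥ x) := by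
  have : ∀ a b : Fin n, ∃ K : ℝ, 0 ≤ K ∧ ∀ x : Fin n → ℝ,
      (x a - x b) ^ 2 ≤ K * (x ⬝ᵥ Gp.lapMatrix ℝ *ᵥ x) := fun a b =>
    (hconn.preconnected a b).elim fun w => aux_reach Gp w
  choose K hK hKx using this
  have hS : 0 ≤ ∑ i, ∑ j, K i j := Finset.sum_nonneg fun i _ => Finset.sum_nonneg fun j _ => hK i j
  refine ⟨(∑ i, ∑ j, K i j) + 1, by linarith, fun x => ?_⟩
  have hQ := aux_nonneg Gp x
  have h1 : ∑ i, ∑ j, (if Gn.Adj i j then (x i - x j) ^ 2 else 0) ≤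
      (∑ i, ∑ j, K i j) * (x ⬝ᵥ Gp.lapMatrix ℝ *ᵥ x) := by
    rw [Finset.sum_mul]
    refine Finset.sum_le_sum fun i _ => ?_
    rw [Finset.sum_mul]
    refine Finset.sum_le_sum fun j _ => ?_
    split_ifs
    · exact hKx i j x
    · exact mul_nonneg (hK i j) hQ
  rw [aux_quad Gn]
  nlinarith [mul_nonneg hS hQ]

lemma aux_upper {n : ℕ} (G : SimpleGraph (Fin n)) [DecidableRel G.Adj] (x : Fin n → ℝ) :
    x ⬝ᵥ G.lapMatrix ℝ *ᵥ x ≤ 2 * G.maxDegree * (x ⬝ᵥ x) := by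
  have h1 : ∑ i, ∑ j, (if G.Adj i j then (x i - x j) ^ 2 else 0) ≤
      ∑ i, ∑ j, ((if G.Adj i j then 2 * x i ^ 2 else 0) + (if G.Adj j i then 2 * x j ^ 2 else 0)) := by
    refine Finset.sum_le_sum fun i _ => Finset.sum_le_sum fun j _ => ?_
    by_cases h : G.Adj i j
    · simp only [h, h.symm, if_true]
      nlinarith [sq_nonneg (x i + x j)]
    · have h' : ¬ G.Adj j i := fun h' => h h'.symm
      simp [h, h']
  have h2 : ∑ i, ∑ j, (if G.Adj j i then 2 * x j ^ 2 else 0) =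
      ∑ i, ∑ j, (if G.Adj i j then 2 * x i ^ 2 else 0) := Finset.sum_comm
  have h3 : ∑ i, ∑ j, (if G.Adj i j then 2 * x i ^ 2 else 0) ≤ 2 * G.maxDegree * (x ⬝ᵥ x) := by
    rw [dotProduct, Finset.mul_sum]
    refine Finset.sum_le_sum fun i _ => ?_
    have hd : (G.degree i : ℝ) ≤ G.maxDegree := by exact_mod_cast G.degree_le_maxDegree i
    have : ∑ j, (if G.Adj i j then 2 * x i ^ 2 else 0) = G.degree i * (2 * x i ^ 2) := by
      rw [SimpleGraph.degree_eq_sum_if_adj, Finset.sum_mul]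
      simp
    rw [this]
    nlinarith [sq_nonneg (x i)]
  simp only [Finset.sum_add_distrib] at h1
  rw [aux_quad]
  linarith

/-- **Signed-graph linear dynamics: consensus vs divergence.**
Let the positive subgraph `Gp` be connected, and let the negative subgraph `Gn`
(edge-disjoint from `Gp`) contain at least one edge.  With Laplacians `L⁺, L⁻`,
max positive degree `Δ⁺`, and dynamics `x(t+1) = (I − αL⁺ + βL⁻) x(t)`, for every
`0 < α < 1/Δ⁺` there is a critical `β* > 0` such that:
(i) for `0 ≤ β < β*` every trajectory converges to the average of the initial value, and
(ii) for `β > β*` almost every initial value yields a trajectory whose (Euclidean) norm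
tends to infinity. -/
theorem signed_dynamics_critical_beta
    {n : ℕ} (hn : 2 ≤ n)
    (Gp Gn : SimpleGraph (Fin n)) [DecidableRel Gp.Adj] [DecidableRel Gn.Adj]
    (hdisj : ∀ i j, ¬ (Gp.Adj i j ∧ Gn.Adj i j))
    (hconn : Gp.Connected)
    (hneg : ∃ i j, Gn.Adj i j)
    (Lp Ln : Matrix (Fin n) (Fin n) ℝ)
    (hLp : Lp = Gp.lapMatrix ℝ) (hLn : Ln = Gn.lapMatrix ℝ)
    (α : ℝ) (hα0 : 0 < α) (hα1 : α < 1 / (Gp.maxDegree : ℝ)) :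
    ∃ βstar : ℝ, 0 < βstar ∧
      (∀ β : ℝ, 0 ≤ β → β < βstar → ∀ x0 : Fin n → ℝ, ∀ i : Fin n,
        Tendsto (fun t : ℕ => (((1 : Matrix (Fin n) (Fin n) ℝ) - α • Lp + β • Ln) ^ t *ᵥ x0) i)
          atTop (𝓝 ((1 / (n : ℝ)) * ∑ j, x0 j))) ∧
      (∀ β : ℝ, βstar < β →
        volume {x0 : Fin n → ℝ |
          ¬ Tendsto (fun t : ℕ =>
              Real.sqrt (∑ i, ((((1 : Matrix (Fin n) (Fin n) ℝ) - α • Lp + β • Ln) ^ t *ᵥ x0) i) ^ 2))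
            atTop atTop} = 0) := by
  subst hLp hLn
  obtain ⟨K, hK, hKx⟩ := aux_bound Gp Gn hconn
  have hquad : ∀ (β : ℝ) (x : Fin n → ℝ),
      x ⬝ᵥ ((1 : Matrix (Fin n) (Fin n) ℝ) - α • Gp.lapMatrix ℝ + β • Gn.lapMatrix ℝ) *ᵥ x =
      x ⬝ᵥ x - α * (x ⬝ᵥ Gp.lapMatrix ℝ *ᵥ x) + β * (x ⬝ᵥ Gn.lapMatrix ℝ *ᵥ x) := by
    intro β x
    rw [add_mulVec, sub_mulVec, one_mulVec, smul_mulVec, smul_mulVec, dotProduct_add,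
      dotProduct_sub, dotProduct_smul, dotProduct_smul, smul_eq_mul, smul_eq_mul]
  have hherm : ∀ β : ℝ,
      ((1 : Matrix (Fin n) (Fin n) ℝ) - α • Gp.lapMatrix ℝ + β • Gn.lapMatrix ℝ).IsHermitian := by
    intro β
    have a := Gp.isSymm_lapMatrix (R := ℝ)
    have b := Gn.isSymm_lapMatrix (R := ℝ)
    rw [Matrix.IsSymm] at a b
    simp [Matrix.IsHermitian, a, b]
  let B : Set ℝ := {β | ∃ x : Fin n → ℝ, 0 < x ⬝ᵥ Gn.lapMatrix ℝ *ᵥ x ∧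
    α * (x ⬝ᵥ Gp.lapMatrix ℝ *ᵥ x) < β * (x ⬝ᵥ Gn.lapMatrix ℝ *ᵥ x)}
  have hBlow : ∀ β ∈ B, α / K ≤ β := by
    rintro β ⟨x, hx, hlt⟩
    have h1 := hKx x
    rw [div_le_iff₀ hK]
    by_contra! hcon
    have hQ := aux_nonneg Gp x
    have hQ' : 0 < x ⬝ᵥ Gp.lapMatrix ℝ *ᵥ x := by
      by_contra! h0
      nlinarith
    by_cases hβ : 0 ≤ β
    · have := mul_le_mul_of_nonneg_left h1 hβ
      nlinarith
    · nlinarith [mul_pos hα0 hQ']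
  have hBne : B.Nonempty := by
    obtain ⟨a, b, hab⟩ := hneg
    let x : Fin n → ℝ := Pi.single a 1
    have hx : 0 < x ⬝ᵥ Gn.lapMatrix ℝ *ᵥ x := by
      have := aux_edge Gn x hab
      have hb : x b = 0 := Pi.single_eq_of_ne hab.ne.symm _
      have ha : x a = 1 := Pi.single_eq_same _ _
      rw [ha, hb] at this
      linarith
    refine ⟨(α * (x ⬝ᵥ Gp.lapMatrix ℝ *ᵥ x) + 1) / (x ⬝ᵥ Gn.lapMatrix ℝ *ᵥ x), x, hx, ?_⟩
    rw [div_mul_cancel₀ _ hx.ne']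
    linarith
  have hBbdd : BddBelow B := ⟨α / K, hBlow⟩
  refine ⟨sInf B, lt_of_lt_of_le (div_pos hα0 hK) (le_csInf hBne hBlow), ?_, ?_⟩
  · intro β hβ0 hβ x0 i
    have hle : ∀ x : Fin n → ℝ, β * (x ⬝ᵥ Gn.lapMatrix ℝ *ᵥ x) ≤ α * (x ⬝ᵥ Gp.lapMatrix ℝ *ᵥ x) ∧
        (β * (x ⬝ᵥ Gn.lapMatrix ℝ *ᵥ x) = α * (x ⬝ᵥ Gp.lapMatrix ℝ *ᵥ x) →
          x ⬝ᵥ Gp.lapMatrix ℝ *ᵥ x = 0) := by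
      intro x
      obtain ⟨b, hb1, hb2⟩ := exists_between hβ
      have hb : b ∉ B := fun h => absurd (csInf_le hBbdd h) (not_le.2 hb2)
      have hQp := aux_nonneg Gp x
      have hQn := aux_nonneg Gn x
      rcases eq_or_lt_of_le hQn with h0 | h0
      · rw [← h0, mul_zero]
        refine ⟨by positivity, fun h => ?_⟩
        rcases mul_eq_zero.1 h.symm with h | h
        · exact absurd h hα0.ne'
        · exact h
      · have h3 : b * (x ⬝ᵥ Gn.lapMatrix ℝ *ᵥ x) ≤ α * (x ⬝ᵥ Gp.lapMatrix ℝ *ᵥ x) := by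
          by_contra! hcon
          exact hb ⟨x, h0, hcon⟩
        have h4 := mul_lt_mul_of_pos_right hb1 h0
        exact ⟨by linarith, fun h => by linarith⟩
    obtain ⟨y, hy, hlim⟩ := aux_conv _ (hherm β)
      (fun x => by rw [hquad]; linarith [(hle x).1])
      (fun x hx => by
        rw [hquad]
        have hu := aux_upper Gp x
        have hQn := aux_nonneg Gn x
        have hΔ : 0 < (Gp.maxDegree : ℝ) := by
          by_contra! h
          have : 1 / (Gp.maxDegree : ℝ) ≤ 0 := div_nonpos_of_nonneg_of_nonpos (by norm_num) h
          linarith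
        rw [lt_div_iff₀ hΔ] at hα1
        have h1 := mul_le_mul_of_nonneg_left hu hα0.le
        have h2 := mul_lt_mul_of_pos_right hα1 hx
        have h3 := mul_nonneg hβ0 hQn
        nlinarith) x0
    have hy0 : y ⬝ᵥ Gp.lapMatrix ℝ *ᵥ y = 0 := by
      apply (hle y).2
      have := hquad β y
      rw [hy] at this
      linarith
    have hconst : ∀ a b, y a = y b := by
      intro a b
      obtain ⟨w⟩ := hconn.preconnected a b
      obtain ⟨K', -, hK'⟩ := aux_reach Gp w
      have := hK' y
      rw [hy0, mul_zero] at this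
      have h2 := pow_eq_zero_iff (two_ne_zero) |>.1 (le_antisymm this (sq_nonneg _))
      linarith
    have hone : ((1 : Matrix (Fin n) (Fin n) ℝ) - α • Gp.lapMatrix ℝ + β • Gn.lapMatrix ℝ) *ᵥ
        (fun _ => 1) = (1 : ℝ) • (fun _ => 1) := by
      rw [add_mulVec, sub_mulVec, one_mulVec, smul_mulVec, smul_mulVec,
        SimpleGraph.lapMatrix_mulVec_const_eq_zero, SimpleGraph.lapMatrix_mulVec_const_eq_zero]
      simp
    have hsum : ∑ j, y j = ∑ j, x0 j := by
      have hl : Tendsto (fun t : ℕ => ∑ j, (((1 : Matrix (Fin n) (Fin n) ℝ) - α • Gp.lapMatrix ℝ +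
          β • Gn.lapMatrix ℝ) ^ t *ᵥ x0) j) atTop (𝓝 (∑ j, y j)) :=
        tendsto_finsetSum _ fun j _ => (tendsto_pi_nhds.1 hlim) j
      refine tendsto_nhds_unique hl ?_
      refine (tendsto_const_nhds).congr fun t => ?_
      have e := aux_symm _ ((hherm β).pow t) (fun _ => 1) x0
      rw [aux_pow _ _ _ hone] at e
      simpa [dotProduct] using e.symm
    have hyi : y i = (1 / (n : ℝ)) * ∑ j, x0 j := by
      rw [← hsum, Finset.sum_congr rfl fun j _ => hconst j i]
      have : (n : ℝ) ≠ 0 := by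
        have : n ≠ 0 := by omega
        exact_mod_cast this
      simp
      field_simp
    rw [← hyi]
    exact (tendsto_pi_nhds.1 hlim) i
  · intro β hβ
    obtain ⟨b, ⟨x, hx, hlt⟩, hb⟩ := exists_lt_of_csInf_lt hBne hβ
    refine aux_div _ (hherm β) x ?_
    rw [hquad]
    have := mul_lt_mul_of_pos_right hb hx
    linarith
end

section
/- Let G be a finite simple graph on n vertices with 0/1 adjacency matrix A, having no isolated vertex and no vertex adjacent to all other vertices, and define A_s = A − (1/n)𝟙𝟙ᵀA, so that (A_s)_{ij} = A_{ij} − deg(j)/n. Regard A_s as a signed graph on the n vertices: a pair {i,j} of distinct vertices is a positive edge if (A_s)_{ij} > 0 and a negative edge if (A_s)_{ij} < 0. If this signed graph is weakly structurally balanced, then G is a disjoint union of vertex-disjoint complete subgraphs, each on more than one vertex, with no edges between different subgraphs. -/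
open Finset Matrix

/-- **Weak structural balance of the normalization signed graph forces clique
partitions.**  Let `G` be a finite simple graph on `n` vertices with adjacency
matrix `A`, having no isolated vertex and no vertex adjacent to all other vertices,
and let `A_s = A − (1/n)𝟙𝟙ᵀA` be the signed adjacency implicitly used by the
normalization layers (positive edge: `(A_s)ᵢⱼ > 0`; negative edge: `(A_s)ᵢⱼ < 0`).
If this signed graph is weakly structurally balanced (a partition into `m ≥ 2`
nonempty parts with only positive edges inside parts and only negative edges between
parts), then `G` is a disjoint union of vertex-disjoint complete subgraphs, each on
more than one vertex, with no edges between different subgraphs. -/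
theorem weak_balance_forces_clique_partition
    {n : ℕ} (hn : 0 < n)
    (G : SimpleGraph (Fin n)) [DecidableRel G.Adj]
    (hnoiso : ∀ v, ∃ w, G.Adj v w)
    (hnodom : ∀ v, ∃ w, w ≠ v ∧ ¬ G.Adj v w)
    (As : Matrix (Fin n) (Fin n) ℝ)
    (hAs : As = G.adjMatrix ℝ -
      (1 / (n : ℝ)) • ((Matrix.of fun _ _ : Fin n => (1 : ℝ)) * G.adjMatrix ℝ))
    (hweak : ∃ (m : ℕ), 2 ≤ m ∧ ∃ f : Fin n → Fin m, Function.Surjective f ∧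
      (∀ i j, i ≠ j → f i = f j → 0 ≤ As i j) ∧
      (∀ i j, f i ≠ f j → As i j ≤ 0)) :
    ∃ (m' : ℕ) (C : Fin n → Fin m'),
      (∀ i j, i ≠ j → (G.Adj i j ↔ C i = C j)) ∧
      (∀ i, ∃ j, j ≠ i ∧ C j = C i) := by
  obtain ⟨m, -, f, -, hin, hout⟩ := hweak
  have hn' : (0 : ℝ) < n := by exact_mod_cast hn
  have hval : ∀ i j, As i j = (if G.Adj i j then 1 else 0) - (G.degree j : ℝ) / n := by
    intro i j
    have h1 : ((Matrix.of fun _ _ : Fin n => (1 : ℝ)) * G.adjMatrix ℝ) i j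
        = (G.degree j : ℝ) := by
      rw [SimpleGraph.mul_adjMatrix_apply]
      simp
    rw [hAs, Matrix.sub_apply, Matrix.smul_apply, h1, SimpleGraph.adjMatrix_apply, smul_eq_mul]
    ring
  have key : ∀ i j, i ≠ j → (G.Adj i j ↔ f i = f j) := by
    intro i j hij
    have hlt : (G.degree j : ℝ) / n < 1 := by
      rw [div_lt_one hn']
      have := G.degree_lt_card_verts j
      rw [Fintype.card_fin] at this
      exact_mod_cast this
    have hpos : 0 < (G.degree j : ℝ) / n := by
      have : 0 < G.degree j := (G.degree_pos_iff_exists_adj j).2 (hnoiso j)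
      have h2 : (0 : ℝ) < G.degree j := by exact_mod_cast this
      exact div_pos h2 hn'
    constructor
    · intro h
      by_contra hne
      have := hout i j hne
      rw [hval, if_pos h] at this
      linarith
    · intro h
      by_contra hne
      have := hin i j hij h
      rw [hval, if_neg hne] at this
      linarith
  refine ⟨m, f, key, fun i => ?_⟩
  obtain ⟨w, hw⟩ := hnoiso i
  exact ⟨w, hw.ne', ((key i w hw.ne).1 hw).symm⟩
end
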